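/- arXiv:math-ph/0603055 — 2 statements merged into one kernel-verified Lean document; each statement's English description precedes it below -/
import Mathlib

section
/- Let d ≥ 1, ħ > 0, σ > 0 and 0 < δ < σ. For z = (v,w) ∈ ℝ^d × ℝ^d write |z| := ‖v‖ + ‖w‖ (Euclidean norms on each factor) and, for z' = (v',w'), define the symplectic pairing z ∧ z' := ⟨w, v'⟩ − ⟨v, w'⟩. For measurable F : ℝ^{2d} → ℂ set ‖F‖_σ := ∫_{ℝ^{2d}} e^{σ|s|} |F(s)| ds. Let F, G : ℝ^{2d} → ℂ be measurable with ‖F‖_σ < ∞ and ‖G‖_σ < ∞, and define the twisted convolution Mb_ħ(F,G)(s) := (2/ħ) ∫_{ℝ^{2d}} F(s¹) G(s − s¹) sin(ħ (s ∧ s¹)/2) ds¹. Then for almost every s the defining integral converges absolutely, and ∫_{ℝ^{2d}} e^{(σ−δ)|s|} |Mb_ħ(F,G)(s)| ds ≤ (1/(e²δ²)) · ‖F‖_σ · ‖G‖_σ. -/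
open MeasureTheory
open scoped RealInnerProductSpace

/-- `|z| = ‖v‖ + ‖w‖` for `z = (v,w)`, with Euclidean norms on each factor. -/
noncomputable def phaseAbs {d : ℕ}
    (z : EuclideanSpace ℝ (Fin d) × EuclideanSpace ℝ (Fin d)) : ℝ :=
  ‖z.1‖ + ‖z.2‖

/-- The symplectic pairing `z ∧ z' = ⟨w, v'⟩ - ⟨v, w'⟩` for `z = (v,w)`, `z' = (v',w')`. -/
noncomputable def wedge {d : ℕ}
    (z z' : EuclideanSpace ℝ (Fin d) × EuclideanSpace ℝ (Fin d)) : ℝ :=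
  ⟪z.2, z'.1⟫ - ⟪z.1, z'.2⟫

/-- The twisted convolution arising as Fourier transform of the Moyal bracket:
`Mb_hbar(F,G)(s) = (2/hbar) ∫ F(s¹) G(s-s¹) sin(hbar (s ∧ s¹)/2) ds¹`. -/
noncomputable def moyalConv {d : ℕ} (hbar : ℝ)
    (F G : EuclideanSpace ℝ (Fin d) × EuclideanSpace ℝ (Fin d) → ℂ)
    (s : EuclideanSpace ℝ (Fin d) × EuclideanSpace ℝ (Fin d)) : ℂ :=
  (2 / hbar : ℝ) *
    ∫ s1, F s1 * G (s - s1) * ((Real.sin (hbar * wedge s s1 / 2) : ℝ) : ℂ)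

section PhaseSpace

variable {d : ℕ}

local notation "E" => EuclideanSpace ℝ (Fin d) × EuclideanSpace ℝ (Fin d)

theorem phaseAbs_nonneg (z : E) : 0 ≤ phaseAbs z := by
  unfold phaseAbs
  positivity

theorem phaseAbs_le_add_sub (s t : E) : phaseAbs s ≤ phaseAbs t + phaseAbs (s - t) := by
  have h₁ := norm_le_norm_add_norm_sub' s.1 t.1
  have h₂ := norm_le_norm_add_norm_sub' s.2 t.2
  simp only [phaseAbs, Prod.fst_sub, Prod.snd_sub]
  linarith

theorem wedge_sub_left_self (s t : E) : wedge (s - t) t = wedge s t := by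
  simp only [wedge, Prod.fst_sub, Prod.snd_sub, inner_sub_left, real_inner_comm t.1 t.2]
  ring

theorem abs_wedge_le (s t : E) : |wedge s t| ≤ phaseAbs s * phaseAbs t := by
  have h₁ := abs_real_inner_le_norm s.2 t.1
  have h₂ := abs_real_inner_le_norm s.1 t.2
  have h₃ := abs_sub ⟪s.2, t.1⟫ ⟪s.1, t.2⟫
  have h₄ : 0 ≤ ‖s.1‖ * ‖t.1‖ := by positivity
  have h₅ : 0 ≤ ‖s.2‖ * ‖t.2‖ := by positivity
  simp only [wedge, phaseAbs]
  nlinarith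

theorem measurable_wedge_right (s : E) : Measurable (wedge s) := by
  unfold wedge
  fun_prop

/-- A linear factor is absorbed by an exponential with loss `δ` in the rate. -/
theorem exp_sub_mul_mul_le {δ : ℝ} (hδ : 0 < δ) (σ x : ℝ) :
    Real.exp ((σ - δ) * x) * x ≤ 1 / (Real.exp 1 * δ) * Real.exp (σ * x) := by
  have h : δ * x * Real.exp 1 ≤ Real.exp (δ * x) := by
    have h₁ := Real.add_one_le_exp (δ * x - 1)
    rw [Real.exp_sub, le_div_iff₀ (Real.exp_pos 1)] at h₁
    linarith
  have h' : Real.exp (σ * x) = Real.exp ((σ - δ) * x) * Real.exp (δ * x) := by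
    rw [← Real.exp_add]
    ring_nf
  rw [h', one_div_mul_eq_div, le_div_iff₀ (by positivity)]
  calc Real.exp ((σ - δ) * x) * x * (Real.exp 1 * δ)
      = Real.exp ((σ - δ) * x) * (δ * x * Real.exp 1) := by ring
    _ ≤ _ := by gcongr

theorem two_div_mul_abs_sin_le {hbar : ℝ} (hhbar : 0 < hbar) (x : ℝ) :
    2 / hbar * |Real.sin (hbar * x / 2)| ≤ |x| := by
  have h : |Real.sin (hbar * x / 2)| ≤ hbar * |x| / 2 := by
    simpa [abs_mul, abs_div, abs_of_pos hhbar] using Real.abs_sin_le_abs (x := hbar * x / 2)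
  calc 2 / hbar * |Real.sin (hbar * x / 2)| ≤ 2 / hbar * (hbar * |x| / 2) := by gcongr
    _ = |x| := by field_simp

/-- Weighted pointwise bound on the kernel of the Moyal bracket, uniform in `hbar`. -/
theorem exp_mul_moyalKernel_le {hbar σ δ : ℝ} (hhbar : 0 < hbar) (hδ : 0 < δ) (hδσ : δ ≤ σ)
    (s t : E) :
    Real.exp ((σ - δ) * phaseAbs s) * (2 / hbar * |Real.sin (hbar * wedge s t / 2)|) ≤
      1 / (Real.exp 1 ^ 2 * δ ^ 2) *
        (Real.exp (σ * phaseAbs t) * Real.exp (σ * phaseAbs (s - t))) := by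
  have ht := phaseAbs_nonneg t
  have hst := phaseAbs_nonneg (s - t)
  have hσδ : 0 ≤ σ - δ := sub_nonneg.mpr hδσ
  have hexp : Real.exp ((σ - δ) * phaseAbs s) ≤
      Real.exp ((σ - δ) * phaseAbs t) * Real.exp ((σ - δ) * phaseAbs (s - t)) := by
    rw [← Real.exp_add, ← mul_add]
    gcongr
    exact phaseAbs_le_add_sub s t
  have hsin : 2 / hbar * |Real.sin (hbar * wedge s t / 2)| ≤ phaseAbs (s - t) * phaseAbs t := by
    refine (two_div_mul_abs_sin_le hhbar _).trans ?_
    rw [← wedge_sub_left_self]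
    exact abs_wedge_le _ _
  calc _ ≤ Real.exp ((σ - δ) * phaseAbs t) * Real.exp ((σ - δ) * phaseAbs (s - t)) *
        (phaseAbs (s - t) * phaseAbs t) := by gcongr
    _ = (Real.exp ((σ - δ) * phaseAbs t) * phaseAbs t) *
        (Real.exp ((σ - δ) * phaseAbs (s - t)) * phaseAbs (s - t)) := by ring
    _ ≤ (1 / (Real.exp 1 * δ) * Real.exp (σ * phaseAbs t)) *
        (1 / (Real.exp 1 * δ) * Real.exp (σ * phaseAbs (s - t))) := by
      exact mul_le_mul (exp_sub_mul_mul_le hδ _ _) (exp_sub_mul_mul_le hδ _ _)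
        (by positivity) (by positivity)
    _ = _ := by ring

end PhaseSpace

/-- Moyal bracket estimate, uniform in `hbar`: with an analyticity loss `δ`,
`‖Mb_hbar(F,G)‖_{σ-δ} ≤ (1/(e²δ²)) ‖F‖_σ ‖G‖_σ`. -/
theorem moyal_bracket_estimate (d : ℕ) (hd : 1 ≤ d) (hbar σ δ : ℝ)
    (hhbar : 0 < hbar) (hσ : 0 < σ) (hδ0 : 0 < δ) (hδσ : δ < σ)
    (F G : EuclideanSpace ℝ (Fin d) × EuclideanSpace ℝ (Fin d) → ℂ)
    (hF : Measurable F) (hG : Measurable G)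
    (hFσ : Integrable (fun s => Real.exp (σ * phaseAbs s) * ‖F s‖) volume)
    (hGσ : Integrable (fun s => Real.exp (σ * phaseAbs s) * ‖G s‖) volume) :
    (∀ᵐ s : EuclideanSpace ℝ (Fin d) × EuclideanSpace ℝ (Fin d),
      Integrable
        (fun s1 => F s1 * G (s - s1) * ((Real.sin (hbar * wedge s s1 / 2) : ℝ) : ℂ))
        volume) ∧
    (∫⁻ s, ENNReal.ofReal
        (Real.exp ((σ - δ) * phaseAbs s) * ‖moyalConv hbar F G s‖) ∂volume) ≤
      ENNReal.ofReal ((1 / (Real.exp 1 ^ 2 * δ ^ 2)) *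
        (∫ s, Real.exp (σ * phaseAbs s) * ‖F s‖) *
        (∫ s, Real.exp (σ * phaseAbs s) * ‖G s‖)) := by
  set f : EuclideanSpace ℝ (Fin d) × EuclideanSpace ℝ (Fin d) → ℝ :=
    fun s => Real.exp (σ * phaseAbs s) * ‖F s‖ with hf
  set g : EuclideanSpace ℝ (Fin d) × EuclideanSpace ℝ (Fin d) → ℝ :=
    fun s => Real.exp (σ * phaseAbs s) * ‖G s‖ with hg
  set C : ℝ := 1 / (Real.exp 1 ^ 2 * δ ^ 2)
  have : (volume : Measure (EuclideanSpace ℝ (Fin d) ×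
      EuclideanSpace ℝ (Fin d))).IsAddRightInvariant :=
    inferInstanceAs ((volume : Measure (EuclideanSpace ℝ (Fin d))).prod
      (volume : Measure (EuclideanSpace ℝ (Fin d)))).IsAddRightInvariant
  have hfg_ae : ∀ᵐ s, Integrable (fun t => f t * g (s - t)) volume :=
    hFσ.ae_convolution_exists (ContinuousLinearMap.mul ℝ ℝ) hGσ
  have hint := hFσ.integrable_convolution (ContinuousLinearMap.mul ℝ ℝ) hGσ
  have hintegral := integral_convolution (ContinuousLinearMap.mul ℝ ℝ) hFσ hGσ
  simp only [convolution_def, ContinuousLinearMap.mul_apply'] at hint hintegral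
  constructor
  · filter_upwards [hfg_ae] with s hs
    have := measurable_wedge_right s
    refine hs.mono' (by fun_prop) (.of_forall fun t => ?_)
    have hle : ∀ z : EuclideanSpace ℝ (Fin d) × EuclideanSpace ℝ (Fin d),
        1 ≤ Real.exp (σ * phaseAbs z) := fun z =>
      Real.one_le_exp (mul_nonneg hσ.le (phaseAbs_nonneg z))
    rw [norm_mul, norm_mul, Complex.norm_real, Real.norm_eq_abs]
    calc ‖F t‖ * ‖G (s - t)‖ * |Real.sin (hbar * wedge s t / 2)|
        ≤ ‖F t‖ * ‖G (s - t)‖ * 1 := by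
          gcongr
          exact Real.abs_sin_le_one _
      _ ≤ f t * g (s - t) := by
          rw [mul_one]
          gcongr
          · exact le_mul_of_one_le_left (norm_nonneg _) (hle _)
          · exact le_mul_of_one_le_left (norm_nonneg _) (hle _)
  · have hbound : ∀ᵐ s, Real.exp ((σ - δ) * phaseAbs s) * ‖moyalConv hbar F G s‖ ≤
        C * ∫ t, f t * g (s - t) := by
      filter_upwards [hfg_ae] with s hs
      have hnorm : Real.exp ((σ - δ) * phaseAbs s) * ‖moyalConv hbar F G s‖ =
          ‖∫ t, ((Real.exp ((σ - δ) * phaseAbs s) * (2 / hbar) : ℝ) : ℂ) *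
            (F t * G (s - t) * ((Real.sin (hbar * wedge s t / 2) : ℝ) : ℂ))‖ := by
        rw [integral_const_mul, moyalConv, norm_mul, norm_mul, Complex.norm_real,
          Complex.norm_real, norm_mul, Real.norm_of_nonneg (Real.exp_pos _).le, mul_assoc]
      rw [hnorm, ← integral_const_mul]
      refine norm_integral_le_of_norm_le (hs.const_mul C) (.of_forall fun t => ?_)
      rw [norm_mul, norm_mul, norm_mul, Complex.norm_real, Complex.norm_real,
        Real.norm_eq_abs (Real.sin _), Real.norm_of_nonneg (by positivity)]
      calc _ = Real.exp ((σ - δ) * phaseAbs s) *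
            (2 / hbar * |Real.sin (hbar * wedge s t / 2)|) * (‖F t‖ * ‖G (s - t)‖) := by ring
        _ ≤ C * (Real.exp (σ * phaseAbs t) * Real.exp (σ * phaseAbs (s - t))) *
            (‖F t‖ * ‖G (s - t)‖) := by
          exact mul_le_mul_of_nonneg_right (exp_mul_moyalKernel_le hhbar hδ0 hδσ.le s t)
            (by positivity)
        _ = C * (f t * g (s - t)) := by
          simp only [hf, hg]
          ring
    have hnonneg : ∀ s, 0 ≤ C * ∫ t, f t * g (s - t) := fun s =>
      mul_nonneg (by positivity) (integral_nonneg fun t => by positivity)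
    calc _ ≤ ∫⁻ s, ENNReal.ofReal (C * ∫ t, f t * g (s - t)) :=
          lintegral_mono_ae (hbound.mono fun s hs => ENNReal.ofReal_le_ofReal hs)
      _ = ENNReal.ofReal (∫ s, C * ∫ t, f t * g (s - t)) :=
          (ofReal_integral_eq_lintegral_ofReal (hint.const_mul C) (.of_forall hnonneg)).symm
      _ = ENNReal.ofReal (C * (∫ s, f s) * ∫ s, g s) := by
          rw [integral_const_mul, hintegral, mul_assoc]
end

section
/- For every real ε ∈ (0,1], setting k := ⌊ε^{−1/2}⌋ (so k ≥ 1), one has (k!)² (2ε)^k ≤ (e⁴/2) · ε^{−1/2} · exp(−(2 − log 2)/√ε). -/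
/-- Stirling's upper bound `n! ≤ e √n (n / e) ^ n` for `n ≠ 0`. -/
theorem Nat.factorial_le_exp_mul_sqrt_mul_pow {n : ℕ} (hn : n ≠ 0) :
    (n.factorial : ℝ) ≤ Real.exp 1 * √n * (n / Real.exp 1) ^ n := by
  obtain ⟨m, rfl⟩ := Nat.exists_eq_succ_of_ne_zero hn
  have h : Stirling.stirlingSeq (m + 1) ≤ Stirling.stirlingSeq 1 :=
    Stirling.stirlingSeq'_antitone (Nat.zero_le m)
  rw [Stirling.stirlingSeq_one, Stirling.stirlingSeq, div_le_iff₀ (by positivity),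
    Real.sqrt_mul zero_le_two] at h
  refine h.trans_eq ?_
  field_simp

/-- The squared factorial is controlled by the optimally truncated exponential: if `n ≠ 0` and
`n² ε ≤ 1`, then `(n!)² (2ε)^n ≤ e² n exp (-(2 - log 2) n)`. -/
theorem Nat.factorial_sq_mul_pow_le {n : ℕ} (hn : n ≠ 0) {ε : ℝ} (hε : 0 ≤ ε)
    (hnε : (n : ℝ) ^ 2 * ε ≤ 1) :
    (n.factorial : ℝ) ^ 2 * (2 * ε) ^ n ≤
      Real.exp 1 ^ 2 * n * Real.exp (-(2 - Real.log 2) * n) := by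
  have hexp : Real.exp (-(2 - Real.log 2) * n) = (2 / Real.exp 1 ^ 2) ^ n := by
    rw [mul_comm, Real.exp_nat_mul, neg_sub, Real.exp_sub, Real.exp_log two_pos, ← Real.exp_nat_mul]
    norm_num
  calc (n.factorial : ℝ) ^ 2 * (2 * ε) ^ n
      ≤ (Real.exp 1 * √n * (n / Real.exp 1) ^ n) ^ 2 * (2 * ε) ^ n := by
        gcongr
        exact Nat.factorial_le_exp_mul_sqrt_mul_pow hn
    _ = Real.exp 1 ^ 2 * n * (2 / Real.exp 1 ^ 2) ^ n * ((n : ℝ) ^ 2 * ε) ^ n := by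
        rw [mul_pow, mul_pow, Real.sq_sqrt n.cast_nonneg, ← pow_mul, mul_comm n 2, pow_mul,
          mul_assoc, ← mul_pow, mul_assoc (_ * _) ((2 / _) ^ n), ← mul_pow]
        congr 2
        ring
    _ ≤ Real.exp 1 ^ 2 * n * (2 / Real.exp 1 ^ 2) ^ n :=
        mul_le_of_le_one_right (by positivity) (pow_le_one₀ (by positivity) hnε)
    _ = _ := by rw [hexp]

/-- Nekhoroshev-type remainder estimate: for `ε ∈ (0,1]` and `k = ⌊ε^{-1/2}⌋` one has
`k ≥ 1` and `(k!)² (2ε)^k ≤ (e⁴/2) ε^{-1/2} exp(-(2 - log 2)/√ε)`. -/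
theorem nekhoroshev_remainder_estimate (ε : ℝ) (hε0 : 0 < ε) (hε1 : ε ≤ 1) :
    1 ≤ ⌊(Real.sqrt ε)⁻¹⌋₊ ∧
    ((⌊(Real.sqrt ε)⁻¹⌋₊).factorial : ℝ) ^ 2 * (2 * ε) ^ ⌊(Real.sqrt ε)⁻¹⌋₊ ≤
      (Real.exp 1 ^ 4 / 2) * (Real.sqrt ε)⁻¹ *
        Real.exp (-(2 - Real.log 2) / Real.sqrt ε) := by
  have hs : 0 < √ε := Real.sqrt_pos.2 hε0
  have hk : 1 ≤ ⌊(√ε)⁻¹⌋₊ :=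
    Nat.one_le_floor_iff _ |>.2 ((one_le_inv₀ hs).2 (Real.sqrt_le_one.2 hε1))
  refine ⟨hk, ?_⟩
  have hle : (⌊(√ε)⁻¹⌋₊ : ℝ) ≤ (√ε)⁻¹ := Nat.floor_le (by positivity)
  have hlt : (√ε)⁻¹ < ⌊(√ε)⁻¹⌋₊ + 1 := Nat.lt_floor_add_one _
  generalize ⌊(√ε)⁻¹⌋₊ = k at hk hle hlt ⊢
  have hkε : (k : ℝ) ^ 2 * ε ≤ 1 := by
    calc (k : ℝ) ^ 2 * ε ≤ (√ε)⁻¹ ^ 2 * ε := by gcongr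
      _ = 1 := by rw [inv_pow, Real.sq_sqrt hε0.le, inv_mul_cancel₀ hε0.ne']
  have hlog : 0 ≤ 2 - Real.log 2 := by linarith [Real.log_two_lt_d9]
  have hconst : Real.exp (2 - Real.log 2) = Real.exp 1 ^ 2 / 2 := by
    rw [Real.exp_sub, Real.exp_log two_pos, ← Real.exp_nat_mul]
    norm_num
  calc (k.factorial : ℝ) ^ 2 * (2 * ε) ^ k
      ≤ Real.exp 1 ^ 2 * k * Real.exp (-(2 - Real.log 2) * k) :=
        Nat.factorial_sq_mul_pow_le (by omega) hε0.le hkε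
    _ ≤ Real.exp 1 ^ 2 * (√ε)⁻¹ *
          Real.exp ((2 - Real.log 2) + -(2 - Real.log 2) / √ε) := by
        gcongr
        rw [div_eq_mul_inv]
        nlinarith
    _ = _ := by
        rw [Real.exp_add, hconst]
        ring
end
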